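/- For symmetric positive definite matrices A, B ∈ ℝ^{m×m}, one has log det A ≤ log det B + tr(B⁻¹(A − B)), with equality if and only if A = B. -/

import Mathlib

open Matrix

/-- A real positive definite matrix `M` satisfies `log det M ≤ tr M - n`. -/
theorem Matrix.PosDef.log_det_le_trace_sub_card {n : Type*} [Fintype n] [DecidableEq n]
    {M : Matrix n n ℝ} (hM : M.PosDef) :
    Real.log M.det ≤ M.trace - Fintype.card n := by
  have hdet := hM.isHermitian.det_eq_prod_eigenvalues
  have htr := hM.isHermitian.trace_eq_sum_eigenvalues
  simp only [RCLike.ofReal_real_eq_id, id_eq] at hdet htr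
  rw [hdet, htr, Real.log_prod fun i _ => (hM.eigenvalues_pos i).ne']
  calc _ ≤ ∑ i, (hM.isHermitian.eigenvalues i - 1) :=
        Finset.sum_le_sum fun i _ => Real.log_le_sub_one_of_pos (hM.eigenvalues_pos i)
    _ = _ := by simp

/-- The only real positive definite matrix with `log det M = tr M - n` is the identity. -/
theorem Matrix.PosDef.eq_one_of_log_det_eq {n : Type*} [Fintype n] [DecidableEq n]
    {M : Matrix n n ℝ} (hM : M.PosDef) (h : Real.log M.det = M.trace - Fintype.card n) :
    M = 1 := by
  have hdet := hM.isHermitian.det_eq_prod_eigenvalues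
  have htr := hM.isHermitian.trace_eq_sum_eigenvalues
  simp only [RCLike.ofReal_real_eq_id, id_eq] at hdet htr
  rw [hdet, htr, Real.log_prod fun i _ => (hM.eigenvalues_pos i).ne'] at h
  have hsum : ∑ i, Real.log (hM.isHermitian.eigenvalues i) =
      ∑ i, (hM.isHermitian.eigenvalues i - 1) := by simpa using h
  rw [Finset.sum_eq_sum_iff_of_le fun i _ =>
    Real.log_le_sub_one_of_pos (hM.eigenvalues_pos i)] at hsum
  have hone : hM.isHermitian.eigenvalues = 1 := by
    funext i
    by_contra hi
    exact (Real.log_lt_sub_one_of_pos (hM.eigenvalues_pos i) hi).ne (hsum i (Finset.mem_univ i))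
  have hdiag : (diagonal (RCLike.ofReal ∘ (1 : n → ℝ)) : Matrix n n ℝ) = 1 := by
    rw [← diagonal_one]
    congr 1
  rw [hM.isHermitian.spectral_theorem, hone, hdiag, map_one]

open scoped MatrixOrder in
/-- A positive definite matrix factors as `Sᴴ * S` with `S` invertible. -/
theorem Matrix.PosDef.exists_isUnit_star_mul_self {n : Type*} [Fintype n] [DecidableEq n]
    {M : Matrix n n ℝ} (hM : M.PosDef) : ∃ S : Matrix n n ℝ, IsUnit S ∧ M = star S * S := by
  obtain ⟨S, hS⟩ := CStarAlgebra.nonneg_iff_eq_star_mul_self.mp hM.posSemidef.nonneg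
  have hU := hM.isUnit
  rw [hS, isUnit_iff_isUnit_det, det_mul] at hU
  exact ⟨S, (isUnit_iff_isUnit_det S).mpr (isUnit_of_mul_isUnit_right hU), hS⟩

/-- For symmetric positive definite `A, B ∈ ℝ^{m×m}`:
`log det A ≤ log det B + tr(B⁻¹ (A − B))`, with equality if and only if `A = B`. -/
theorem stmt_6 {m : ℕ} (A B : Matrix (Fin m) (Fin m) ℝ)
    (hA : A.PosDef) (hB : B.PosDef) :
    Real.log A.det ≤ Real.log B.det + (B⁻¹ * (A - B)).trace ∧
      (Real.log A.det = Real.log B.det + (B⁻¹ * (A - B)).trace ↔ A = B) := by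
  obtain ⟨S, hS, hBS⟩ := hB.inv.exists_isUnit_star_mul_self
  have hM : (S * A * star S).PosDef := hS.posDef_star_right_conjugate_iff.mpr hA
  have hBdet : IsUnit B.det := hB.det_pos.ne'.isUnit
  have hdet : (S * A * star S).det = B.det⁻¹ * A.det := by
    have h := congrArg det hBS
    rw [det_nonsing_inv, Ring.inverse_eq_inv', det_mul] at h
    rw [det_mul, det_mul, h]
    ring
  have hlog : Real.log (S * A * star S).det = Real.log A.det - Real.log B.det := by
    rw [hdet, Real.log_mul (inv_ne_zero hB.det_pos.ne') hA.det_pos.ne', Real.log_inv]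
    ring
  have htr : (B⁻¹ * (A - B)).trace = (S * A * star S).trace - Fintype.card (Fin m) := by
    rw [mul_sub, nonsing_inv_mul _ hBdet, trace_sub, trace_one, hBS, trace_mul_cycle S]
  refine ⟨?_, fun h => ?_, fun h => by simp [h]⟩
  · have := hM.log_det_le_trace_sub_card
    linarith
  · have hone := hM.eq_one_of_log_det_eq (by linarith)
    have hconj : B⁻¹ * A * B⁻¹ = B⁻¹ := by
      calc B⁻¹ * A * B⁻¹ = star S * (S * A * star S) * S := by simp only [hBS, mul_assoc]
        _ = B⁻¹ := by rw [hone, mul_one, hBS]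
    calc A = B * (B⁻¹ * A * B⁻¹) * B := by
          simp only [mul_assoc, nonsing_inv_mul _ hBdet, mul_one]
          rw [mul_nonsing_inv_cancel_left _ _ hBdet]
      _ = B := by rw [hconj, mul_nonsing_inv _ hBdet, one_mul]
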